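/- A signed graph Σ (finite, no half edges) is balanced if and only if it admits a set-labeling, i.e., an injective f : V → Finset ℕ with σ(uv) = (-1)^{|f(u) Δ f(v)|} for all edges uv. -/

import Mathlib

def walkSign {V : Type*} {G : SimpleGraph V} (σ : Sym2 V → ℤ) {u v : V} (w : G.Walk u v) : ℤ :=
  (w.edges.map σ).prod

theorem walkSign_nil {V : Type*} {G : SimpleGraph V} (σ : Sym2 V → ℤ) {u : V} :
    walkSign σ (SimpleGraph.Walk.nil : G.Walk u u) = 1 := by simp [walkSign]

theorem walkSign_cons {V : Type*} {G : SimpleGraph V} (σ : Sym2 V → ℤ) {u v x : V}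
    (h : G.Adj u v) (w : G.Walk v x) :
    walkSign σ (SimpleGraph.Walk.cons h w) = σ s(u, v) * walkSign σ w := by simp [walkSign]

theorem walkSign_append {V : Type*} {G : SimpleGraph V} (σ : Sym2 V → ℤ) {u v x : V}
    (p : G.Walk u v) (w : G.Walk v x) :
    walkSign σ (p.append w) = walkSign σ p * walkSign σ w := by simp [walkSign]

theorem walkSign_reverse {V : Type*} {G : SimpleGraph V} (σ : Sym2 V → ℤ) {u v : V}
    (p : G.Walk u v) : walkSign σ p.reverse = walkSign σ p := by
  simp [walkSign, List.prod_reverse]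

theorem walkSign_eq_pow {V : Type*} {G : SimpleGraph V} (σ : Sym2 V → ℤ)
    (hσ : ∀ e ∈ G.edgeSet, σ e = 1 ∨ σ e = -1) {u v : V} (w : G.Walk u v) :
    walkSign σ w = (-1) ^ (w.edges.filter (fun e => σ e = -1)).length := by
  induction w with
  | nil => simp [walkSign]
  | cons h p ih =>
    rw [walkSign_cons, ih, SimpleGraph.Walk.edges_cons, List.filter_cons]
    rcases hσ _ ((SimpleGraph.mem_edgeSet G).2 h) with h1 | h1
    · simp [h1]
    · simp [h1, pow_succ]

theorem sign_symmDiff (A B : Finset ℕ) :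
    (-1 : ℤ) ^ (symmDiff A B).card = (-1) ^ A.card * (-1) ^ B.card := by
  have h : (symmDiff A B).card + 2 * (A ∩ B).card = A.card + B.card := by
    have h1 : (symmDiff A B).card = (A \ B).card + (B \ A).card := by
      rw [symmDiff_def, Finset.sup_eq_union, Finset.card_union_of_disjoint disjoint_sdiff_sdiff]
    have h2 := Finset.card_sdiff_add_card_inter A B
    have h3 := Finset.card_sdiff_add_card_inter B A
    rw [Finset.inter_comm B A] at h3
    omega
  rw [← pow_add, ← h, pow_add, pow_mul]; simp

theorem path_sign_aux {V : Type*} {G : SimpleGraph V} (σ : Sym2 V → ℤ) {u v : V}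
    (p : G.Walk v u) (hp : p.IsPath) (he : s(u, v) ∈ p.edges) :
    walkSign σ p = σ s(u, v) := by
  cases p with
  | nil => simp at he
  | cons h q =>
    rw [SimpleGraph.Walk.cons_isPath_iff] at hp
    rw [SimpleGraph.Walk.edges_cons, List.mem_cons] at he
    rcases he with he | he
    · rw [Sym2.eq_swap, Sym2.congr_right] at he
      subst he
      rw [SimpleGraph.Walk.isPath_iff_eq_nil] at hp
      rw [hp.1, walkSign_cons, walkSign_nil, Sym2.eq_swap, mul_one]
    · exact absurd (q.snd_mem_support_of_mem_edges he) hp.2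

theorem walkSign_bypass {V : Type*} [DecidableEq V] {G : SimpleGraph V} (σ : Sym2 V → ℤ)
    (hσ : ∀ e ∈ G.edgeSet, σ e = 1 ∨ σ e = -1)
    (hc : ∀ (v : V) (w : G.Walk v v), w.IsCycle → walkSign σ w = 1) {u v : V}
    (w : G.Walk u v) : walkSign σ w.bypass = walkSign σ w := by
  induction w with
  | nil => simp [SimpleGraph.Walk.bypass]
  | @cons a b c h p ih =>
    rw [walkSign_cons, ← ih, SimpleGraph.Walk.bypass]
    split_ifs with hs
    · have hp := p.bypass_isPath
      have key : σ s(a, b) * walkSign σ (p.bypass.takeUntil a hs) = 1 := by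
        by_cases he : s(a, b) ∈ (p.bypass.takeUntil a hs).edges
        · rw [path_sign_aux σ _ (hp.takeUntil hs) he]
          rcases hσ _ ((SimpleGraph.mem_edgeSet G).2 h) with h1 | h1 <;> simp [h1]
        · rw [← walkSign_cons σ h]
          exact hc _ _ ((SimpleGraph.Walk.cons_isCycle_iff _ h).2 ⟨hp.takeUntil hs, he⟩)
      conv_rhs => rw [← SimpleGraph.Walk.take_spec p.bypass hs, walkSign_append, ← mul_assoc, key,
        one_mul]
    · rw [walkSign_cons]

theorem balanced_iff_admits_set_labeling {V : Type*} [Fintype V]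
    (G : SimpleGraph V) (σ : Sym2 V → ℤ)
    (hσ : ∀ e ∈ G.edgeSet, σ e = 1 ∨ σ e = -1) :
    (∀ (v : V) (w : G.Walk v v), w.IsCycle →
      Even ((w.edges.filter (fun e => σ e = -1)).length)) ↔
    ∃ f : V → Finset ℕ, Function.Injective f ∧
      ∀ u v : V, G.Adj u v → σ s(u, v) = (-1 : ℤ) ^ (symmDiff (f u) (f v)).card := by
  classical
  constructor
  · intro hb
    have hc : ∀ (v : V) (w : G.Walk v v), w.IsCycle → walkSign σ w = 1 := fun v w hw => by
      rw [walkSign_eq_pow σ hσ]; exact (hb v w hw).neg_one_pow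
    have hcl : ∀ (v : V) (w : G.Walk v v), walkSign σ w = 1 := fun v w => by
      rw [← walkSign_bypass σ hσ hc, SimpleGraph.Walk.isPath_iff_eq_nil.1 w.bypass_isPath,
        walkSign_nil]
    have hr : ∀ v : V, G.Reachable (G.connectedComponentMk v).out v := fun v =>
      SimpleGraph.ConnectedComponent.exact (Quot.out_eq (G.connectedComponentMk v))
    have hg : ∃ g : V → ℤ, (∀ v, g v = 1 ∨ g v = -1) ∧
        ∀ u v, G.Adj u v → σ s(u, v) = g u * g v := by
      refine ⟨fun v => walkSign σ (hr v).some, fun v => ?_, fun u v huv => ?_⟩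
      · simp only [walkSign_eq_pow σ hσ]
        exact neg_one_pow_eq_or ℤ _
      · have key : ∀ (r s : V) (p : G.Walk r u) (q : G.Walk s v), r = s →
            σ s(u, v) = walkSign σ p * walkSign σ q := by
          rintro r s p q rfl
          have h1 := hcl _ (p.append (SimpleGraph.Walk.cons huv q.reverse))
          rw [walkSign_append, walkSign_cons, walkSign_reverse] at h1
          rw [walkSign_eq_pow σ hσ p, walkSign_eq_pow σ hσ q] at h1 ⊢
          rcases neg_one_pow_eq_or ℤ (p.edges.filter (fun e => σ e = -1)).length with h2 | h2 <;>
          rcases neg_one_pow_eq_or ℤ (q.edges.filter (fun e => σ e = -1)).length with h3 | h3 <;>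
          rw [h2, h3] at h1 ⊢ <;> linarith
        apply key
        rw [SimpleGraph.ConnectedComponent.connectedComponentMk_eq_of_adj huv]
    obtain ⟨g, hg1, hg2⟩ := hg
    let e := Fintype.equivFin V
    refine ⟨fun v => if g v = 1 then {2 * (e v : ℕ), 2 * (e v : ℕ) + 1} else {2 * (e v : ℕ)},
      fun u v huv => ?_, fun u v huv => ?_⟩
    · have h1 : 2 * (e u : ℕ) ∈ (if g v = 1 then {2 * (e v : ℕ), 2 * (e v : ℕ) + 1}
          else {2 * (e v : ℕ)} : Finset ℕ) := by
        beta_reduce at huv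
        rw [← huv]
        split_ifs <;> simp
      apply e.injective
      apply Fin.ext
      split_ifs at h1 <;> simp at h1 <;> omega
    · have hs : ∀ v, (-1 : ℤ) ^ (if g v = 1 then {2 * (e v : ℕ), 2 * (e v : ℕ) + 1}
          else {2 * (e v : ℕ)} : Finset ℕ).card = g v := fun v => by
        rcases hg1 v with h | h <;> simp [h]
      rw [sign_symmDiff, hs, hs, hg2 u v huv]
  · rintro ⟨f, -, hf⟩ v w -
    have key : ∀ {a b : V} (p : G.Walk a b),
        walkSign σ p = (-1) ^ (f a).card * (-1) ^ (f b).card := by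
      intro a b p
      induction p with
      | nil => rw [walkSign_nil, ← mul_pow]; simp
      | @cons a b c h p ih =>
        rw [walkSign_cons, ih, hf _ _ h, sign_symmDiff]
        rcases neg_one_pow_eq_or ℤ (f b).card with h2 | h2 <;> rw [h2] <;> ring
    have h1 := key w
    rw [walkSign_eq_pow σ hσ, ← mul_pow] at h1
    simp only [mul_neg, mul_one, neg_neg, one_pow] at h1
    exact (neg_one_pow_eq_one_iff_even (by norm_num)).1 h1
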